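/- arXiv:1109.5745 — 2 statements merged into one kernel-verified Lean document; each statement's English description precedes it below -/
import Mathlib

section
/- Every 4×4 complex matrix g satisfying g J g* = J can be written as g = k·p, where k is a 4×4 unitary matrix satisfying k J k* = J, and p is a block matrix of the form [[h, h·X], [0, (h*)⁻¹]] with h an invertible 2×2 complex matrix and X a Hermitian 2×2 complex matrix (X* = X). -/
open Matrix

noncomputable section

abbrev M2 := Matrix (Fin 2) (Fin 2) ℂ
abbrev M4 := Matrix (Fin 2 ⊕ Fin 2) (Fin 2 ⊕ Fin 2) ℂ

/-- The matrix `J = [[0, i·I₂], [−i·I₂, 0]]`. -/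
def Jmat : M4 := fromBlocks 0 (Complex.I • 1) (-(Complex.I • 1)) 0

theorem Jmat_mul_self : Jmat * Jmat = 1 := by
  simp [Jmat, fromBlocks_multiply, smul_smul, ← fromBlocks_one]

theorem conjTranspose_mul_Jmat_mul {g : M4} (hg : g * Jmat * gᴴ = Jmat) :
    gᴴ * Jmat * g = Jmat := by
  have h1 : g * (Jmat * gᴴ * Jmat) = 1 := by
    rw [← Matrix.mul_assoc, ← Matrix.mul_assoc, hg, Jmat_mul_self]
  have h2 := mul_eq_one_comm.mp h1
  calc gᴴ * Jmat * g = Jmat * Jmat * (gᴴ * Jmat * g) := by rw [Jmat_mul_self, Matrix.one_mul]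
    _ = Jmat * (Jmat * gᴴ * Jmat * g) := by simp only [Matrix.mul_assoc]
    _ = Jmat := by rw [h2, Matrix.mul_one]

theorem conjTranspose_fromBlocks_mul_Jmat_mul_eq_iff (A B C D : M2) :
    (fromBlocks A B C D)ᴴ * Jmat * fromBlocks A B C D = Jmat ↔
      Aᴴ * C = Cᴴ * A ∧ Aᴴ * D - Cᴴ * B = 1 ∧ Bᴴ * C - Dᴴ * A = -1 ∧ Bᴴ * D = Dᴴ * B := by
  have key : (fromBlocks A B C D)ᴴ * Jmat * fromBlocks A B C D =
      Complex.I • fromBlocks (Aᴴ * C - Cᴴ * A) (Aᴴ * D - Cᴴ * B)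
        (Bᴴ * C - Dᴴ * A) (Bᴴ * D - Dᴴ * B) := by
    simp [Jmat, fromBlocks_conjTranspose, fromBlocks_multiply, fromBlocks_smul,
      sub_eq_neg_add]
  have hJ : Jmat = Complex.I • fromBlocks (0 : M2) 1 (-1) 0 := by
    simp [Jmat, fromBlocks_smul]
  rw [key]
  nth_rewrite 1 [hJ]
  rw [(smul_right_injective M4 Complex.I_ne_zero).eq_iff, fromBlocks_inj, sub_eq_zero, sub_eq_zero]

open scoped ComplexOrder MatrixOrder in
/-- If `[A; C]` has a left inverse `[E, F]`, its Gram matrix is `hᴴ * h` with `h` invertible. -/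
theorem exists_isUnit_conjTranspose_mul_self {n : Type*} [Fintype n] [DecidableEq n]
    (A C E F : Matrix n n ℂ) (hl : E * A + F * C = 1) :
    ∃ h : Matrix n n ℂ, IsUnit h ∧ Aᴴ * A + Cᴴ * C = hᴴ * h := by
  have hlr : fromCols E F * fromRows A C = 1 := by rw [fromCols_mul_fromRows, hl]
  have hinj : Function.Injective (fromRows A C).mulVec :=
    Function.LeftInverse.injective (g := (fromCols E F).mulVec) fun v => by
      rw [mulVec_mulVec, hlr, one_mulVec]
  have hP := PosDef.conjTranspose_mul_self _ hinj
  rw [conjTranspose_fromRows_eq_fromCols_conjTranspose, fromCols_mul_fromRows] at hP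
  obtain ⟨h, hh⟩ := CStarAlgebra.nonneg_iff_eq_star_mul_self.mp hP.posSemidef.nonneg
  refine ⟨h, ?_, hh⟩
  have hu := hP.isUnit
  rw [hh, isUnit_iff_isUnit_det, det_mul] at hu
  exact (isUnit_iff_isUnit_det h).mpr (isUnit_of_mul_isUnit_right hu)

/-- Every `g` with `g J g* = J` factors as `g = k·p` with `k` unitary satisfying
`k J k* = J`, and `p = [[h, h·X], [0, (h*)⁻¹]]` with `h` invertible and `X` Hermitian. -/
theorem stmt3 (g : M4) (hg : g * Jmat * gᴴ = Jmat) :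
    ∃ (k : M4) (h X : M2),
      k * kᴴ = 1 ∧ k * Jmat * kᴴ = Jmat ∧ IsUnit h ∧ Xᴴ = X ∧
      g = k * fromBlocks h (h * X) 0 (hᴴ)⁻¹ := by
  have hg' := conjTranspose_mul_Jmat_mul hg
  obtain ⟨A, B, C, D, rfl⟩ : ∃ A B C D, g = fromBlocks A B C D :=
    ⟨_, _, _, _, (fromBlocks_toBlocks g).symm⟩
  obtain ⟨hAC, hADCB, hBCDA, -⟩ := (conjTranspose_fromBlocks_mul_Jmat_mul_eq_iff A B C D).mp hg'
  obtain ⟨h, hu, hh⟩ := exists_isUnit_conjTranspose_mul_self A C Dᴴ (-Bᴴ) (by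
    rw [Matrix.neg_mul, ← sub_eq_add_neg, ← neg_sub, hBCDA, neg_neg])
  have hdet : IsUnit h.det := (isUnit_iff_isUnit_det h).mp hu
  have hdet' : IsUnit hᴴ.det := (isUnit_iff_isUnit_det _).mp hu.star
  set k : M4 := fromBlocks (A * h⁻¹) (-(C * h⁻¹)) (C * h⁻¹) (A * h⁻¹) with hk
  have hgram : hᴴ⁻¹ * Aᴴ * A + hᴴ⁻¹ * Cᴴ * C = h := by
    rw [Matrix.mul_assoc, Matrix.mul_assoc, ← Matrix.mul_add, hh,
      nonsing_inv_mul_cancel_left _ _ hdet']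
  have hcross : hᴴ⁻¹ * Aᴴ * C = hᴴ⁻¹ * Cᴴ * A := by
    rw [Matrix.mul_assoc, hAC, Matrix.mul_assoc]
  have hsymp : hᴴ⁻¹ * Aᴴ * D - hᴴ⁻¹ * Cᴴ * B = hᴴ⁻¹ := by
    rw [Matrix.mul_assoc, Matrix.mul_assoc, ← Matrix.mul_sub, hADCB, Matrix.mul_one]
  have hkH : kᴴ = fromBlocks (hᴴ⁻¹ * Aᴴ) (hᴴ⁻¹ * Cᴴ) (-(hᴴ⁻¹ * Cᴴ)) (hᴴ⁻¹ * Aᴴ) := by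
    simp [hk, fromBlocks_conjTranspose, conjTranspose_nonsing_inv]
  have hkk : kᴴ * k = 1 := by
    rw [hkH, hk, fromBlocks_multiply, ← fromBlocks_one]
    simp only [Matrix.mul_neg, Matrix.neg_mul, ← Matrix.mul_assoc, hcross, neg_neg,
      neg_add_cancel]
    rw [add_comm (hᴴ⁻¹ * Cᴴ * C * h⁻¹), ← Matrix.add_mul, hgram, mul_nonsing_inv _ hdet]
  have hkk' : k * kᴴ = 1 := mul_eq_one_comm.mp hkk
  have hcomm : k * Jmat = Jmat * k := by
    simp [hk, Jmat, fromBlocks_multiply]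
  have hkJ : k * Jmat * kᴴ = Jmat := by
    rw [hcomm, Matrix.mul_assoc, hkk', Matrix.mul_one]
  set Y : M2 := hᴴ⁻¹ * Aᴴ * B + hᴴ⁻¹ * Cᴴ * D with hY
  have hp : kᴴ * fromBlocks A B C D = fromBlocks h (h * (h⁻¹ * Y)) 0 hᴴ⁻¹ := by
    rw [hkH, fromBlocks_multiply, hgram, mul_nonsing_inv_cancel_left _ _ hdet,
      Matrix.neg_mul, Matrix.neg_mul, hcross, neg_add_cancel, neg_add_eq_sub, hsymp]
  have hpJ : (kᴴ * fromBlocks A B C D)ᴴ * Jmat * (kᴴ * fromBlocks A B C D) = Jmat := by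
    calc _ = (fromBlocks A B C D)ᴴ * (k * Jmat * kᴴ) * fromBlocks A B C D := by
          simp only [conjTranspose_mul, conjTranspose_conjTranspose, Matrix.mul_assoc]
      _ = Jmat := by rw [hkJ, hg']
  rw [hp] at hpJ
  obtain ⟨-, -, -, hX⟩ := (conjTranspose_fromBlocks_mul_Jmat_mul_eq_iff _ _ _ _).mp hpJ
  refine ⟨k, h, h⁻¹ * Y, hkk', hkJ, hu, ?_, ?_⟩
  · rw [conjTranspose_mul h, Matrix.mul_assoc, mul_nonsing_inv _ hdet', Matrix.mul_one,
      conjTranspose_nonsing_inv, conjTranspose_conjTranspose,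
      nonsing_inv_mul_cancel_left _ _ hdet] at hX
    exact hX
  · rw [← hp, ← Matrix.mul_assoc, hkk', Matrix.one_mul]
end
end

section
/- Let g = [[A, B], [C, D]] (in 2×2 blocks) satisfy g I_{2,2} g* = I_{2,2}, let Z be a 2×2 unitary matrix, and let φ be the map W ↦ (A·W + B)(C·W + D)⁻¹, defined on a neighborhood of Z (C·Z + D and A·Z + B are invertible). Then for every 2×2 complex matrix X, det( φ(Z)⁻¹ · (Dφ)_Z(Z·X) ) = det( (A·Z + B)⁻¹·B − (C·Z + D)⁻¹·D ) · det X, where (Dφ)_Z denotes the Fréchet derivative of φ at Z. (This says the linear fractional action of U(2,2) on U(2) is conformal for the bi-invariant Lorentzian metric ⟨uX, uX⟩ = −det X, with conformal factor det((AZ+B)⁻¹B − (CZ+D)⁻¹D).) -/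
open Matrix

noncomputable section

attribute [local instance] Matrix.normedAddCommGroup Matrix.normedSpace

/-- The matrix `I_{2,2} = diag(1, 1, −1, −1)`. -/
def I22 : M4 := fromBlocks 1 0 0 (-1)

/-- The linear fractional map `φ : W ↦ (A·W + B)(C·W + D)⁻¹`. -/
def lft (A B C D : M2) (W : M2) : M2 := (A * W + B) * (C * W + D)⁻¹

/-- In a complete normed algebra, the derivative of `w ↦ (a w + b)(c w + d)⁻¹`. -/
theorem fderiv_linearFractional_apply {𝕜 R : Type*} [NontriviallyNormedField 𝕜] [NormedRing R]
    [NormedAlgebra 𝕜 R] [CompleteSpace R] (a b c d z h : R) (hu : IsUnit (c * z + d)) :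
    fderiv 𝕜 (fun w => (a * w + b) * Ring.inverse (c * w + d)) z h =
      a * h * Ring.inverse (c * z + d) -
        (a * z + b) * (Ring.inverse (c * z + d) * (c * h) * Ring.inverse (c * z + d)) := by
  obtain ⟨u, hu⟩ := hu
  have hnum (a b : R) : HasFDerivAt (fun w => a * w + b) (ContinuousLinearMap.mul 𝕜 R a) z :=
    (ContinuousLinearMap.mul 𝕜 R a).hasFDerivAt.add_const b
  have hinv : HasFDerivAt Ring.inverse _ (c * z + d) := hu ▸ hasFDerivAt_ringInverse (𝕜 := 𝕜) u
  have hmul := (hnum a b).mul' (hinv.comp z (hnum c d))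
  have := congrArg (· h) hmul.fderiv
  refine this.trans ?_
  simp [← hu]
  abel

theorem fderiv_lft_apply (A B C D Z H : M2) (hQ : IsUnit (C * Z + D)) :
    fderiv ℂ (lft A B C D) Z H =
      A * H * (C * Z + D)⁻¹ - (A * Z + B) * ((C * Z + D)⁻¹ * (C * H) * (C * Z + D)⁻¹) := by
  have hlft : lft A B C D = fun W => (A * W + B) * Ring.inverse (C * W + D) := by
    funext W
    rw [lft, nonsing_inv_eq_ringInverse]
  rw [hlft, nonsing_inv_eq_ringInverse]
  exact @fderiv_linearFractional_apply ℂ M2 _ Matrix.linftyOpNormedRing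
    Matrix.linftyOpNormedAlgebra (inferInstanceAs (CompleteSpace (Fin 2 → Fin 2 → ℂ)))
    A B C D Z H hQ

open scoped ComplexOrder in
/-- A common kernel vector of `P` and `Q` forces `Q` to be singular, so `Pᴴ P = Qᴴ Q` together
with a left Bézout relation makes `Q` invertible. -/
theorem isUnit_of_conjTranspose_mul_self_eq {P Q E F : M2} (hPQ : Pᴴ * P = Qᴴ * Q)
    (hEF : E * P + F * Q = 1) : IsUnit Q := by
  rw [isUnit_iff_isUnit_det, isUnit_iff_ne_zero]
  intro hdet
  obtain ⟨v, hv, hQv⟩ := exists_mulVec_eq_zero_iff.2 hdet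
  have hPv : P *ᵥ v = 0 := by
    rw [← conjTranspose_mul_self_mulVec_eq_zero, hPQ, ← mulVec_mulVec, hQv, mulVec_zero]
  apply hv
  rw [← one_mulVec v, ← hEF, add_mulVec, ← mulVec_mulVec, ← mulVec_mulVec, hPv, hQv]
  simp

theorem I22_mul_I22 : I22 * I22 = 1 := by
  simp [I22, fromBlocks_multiply]

theorem conjTranspose_mul_I22_mul {g : M4} (hg : g * I22 * gᴴ = I22) : gᴴ * I22 * g = I22 := by
  have h : (g * I22) * (gᴴ * I22) = 1 := by
    rw [← Matrix.mul_assoc, hg, I22_mul_I22]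
  have h' := congrArg (· * I22) (mul_eq_one_comm.1 h)
  simpa [Matrix.mul_assoc, I22_mul_I22] using h'

/-- The numerator and the denominator of the action of `U(2,2)` on `U(2)` are invertible. -/
theorem isUnit_num_and_denom {A B C D Z : M2}
    (hg : fromBlocks A B C D * I22 * (fromBlocks A B C D)ᴴ = I22) (hZ : Z * Zᴴ = 1) :
    IsUnit (A * Z + B) ∧ IsUnit (C * Z + D) := by
  have h := conjTranspose_mul_I22_mul hg
  simp only [I22, fromBlocks_conjTranspose, fromBlocks_multiply, fromBlocks_inj, Matrix.mul_zero,
    Matrix.mul_one, add_zero, zero_add, Matrix.mul_neg, Matrix.neg_mul] at h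
  obtain ⟨h₁, h₂, h₃, h₄⟩ := h
  have hZ' : Zᴴ * Z = 1 := mul_eq_one_comm.1 hZ
  have hPQ : (A * Z + B)ᴴ * (A * Z + B) = (C * Z + D)ᴴ * (C * Z + D) := by
    rw [← sub_eq_zero]
    calc _ = Zᴴ * (Aᴴ * A + -(Cᴴ * C)) * Z + Zᴴ * (Aᴴ * B + -(Cᴴ * D)) +
          (Bᴴ * A + -(Dᴴ * C)) * Z + (Bᴴ * B + -(Dᴴ * D)) := by
          simp only [conjTranspose_add, conjTranspose_mul]
          noncomm_ring
      _ = 0 := by simp [h₁, h₂, h₃, h₄, hZ']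
  have hEF : -Bᴴ * (A * Z + B) + Dᴴ * (C * Z + D) = 1 := by
    calc _ = -((Bᴴ * A + -(Dᴴ * C)) * Z) - (Bᴴ * B + -(Dᴴ * D)) := by noncomm_ring
      _ = 1 := by simp [h₃, h₄]
  exact ⟨isUnit_of_conjTranspose_mul_self_eq hPQ.symm ((add_comm _ _).trans hEF),
    isUnit_of_conjTranspose_mul_self_eq hPQ hEF⟩

/-- The linear fractional action of `U(2,2)` on `U(2)` is conformal:
`det(φ(Z)⁻¹·(Dφ)_Z(Z·X)) = det((AZ+B)⁻¹B − (CZ+D)⁻¹D)·det X`. -/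
theorem stmt8 (A B C D Z : M2)
    (hg : fromBlocks A B C D * I22 * (fromBlocks A B C D)ᴴ = I22)
    (hZ : Z * Zᴴ = 1) (X : M2) :
    ((lft A B C D Z)⁻¹ * fderiv ℂ (lft A B C D) Z (Z * X)).det =
      ((A * Z + B)⁻¹ * B - (C * Z + D)⁻¹ * D).det * X.det := by
  obtain ⟨hP, hQ⟩ := isUnit_num_and_denom hg hZ
  rw [fderiv_lft_apply _ _ _ _ _ _ hQ, lft]
  have hA : A * Z = (A * Z + B) - B := by abel
  have hC : C * Z = (C * Z + D) - D := by abel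
  rw [← Matrix.mul_assoc A, ← Matrix.mul_assoc C]
  generalize A * Z = A', C * Z = C' at *
  generalize A' + B = P, C' + D = Q at *
  subst hA hC
  rw [isUnit_iff_isUnit_det] at hP hQ
  have key : (P * Q⁻¹)⁻¹ * ((P - B) * X * Q⁻¹ - P * (Q⁻¹ * ((Q - D) * X) * Q⁻¹)) =
      Q * (-(P⁻¹ * B - Q⁻¹ * D) * X) * Q⁻¹ := by
    rw [Matrix.mul_inv_rev, nonsing_inv_nonsing_inv _ hQ]
    calc _ = Q * ((P⁻¹ * P) * X - P⁻¹ * B * X - (P⁻¹ * P) * ((Q⁻¹ * Q) * X - Q⁻¹ * D * X)) *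
          Q⁻¹ := by noncomm_ring
      _ = _ := by
        rw [nonsing_inv_mul _ hP, nonsing_inv_mul _ hQ]
        noncomm_ring
  rw [key, det_conj ((isUnit_iff_isUnit_det _).2 hQ), det_mul, det_neg]
  simp
end
end
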